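/- arXiv:1911.04587 — 2 statements merged into one kernel-verified Lean document; each statement's English description precedes it below -/
import Mathlib

section
/- Let T be a type, m, n ∈ ℕ, λ : T → Fin m → ℝ, and B ≥ 0 such that for every t : T, ∑_{j} |λ t j| ≤ B. Let Δ ≥ 2B with Δ > 0, let ε > 0, and set σ = Δ/ε. For a dataset D : Fin n → T define q(D) : Fin m → ℝ by q(D) j = ∑_{i} λ (D i) j, and let μ_D = Lap_σ^m(q(D)) be the product measure on (Fin m → ℝ) whose j-th factor has density x ↦ (1/(2σ))·exp(−|x − q(D) j|/σ) with respect to Lebesgue measure. Then for any two datasets D, D' : Fin n → T that agree at every index except possibly one, and every measurable set Z ⊆ (Fin m → ℝ), μ_D(Z) ≤ exp(ε) · μ_{D'}(Z). -/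
open MeasureTheory

/-- The product Laplace measure `Lap_σ^m(c)` on `Fin m → ℝ`: the product measure whose
j-th factor is the measure on ℝ with density `x ↦ (1/(2σ))·exp(−|x − c j|/σ)`
with respect to Lebesgue measure. -/
noncomputable def lapPi (σ : ℝ) {m : ℕ} (c : Fin m → ℝ) : Measure (Fin m → ℝ) :=
  Measure.pi fun j =>
    volume.withDensity fun x => ENNReal.ofReal ((1 / (2 * σ)) * Real.exp (-|x - c j| / σ))

theorem MeasureTheory.Measure.pi_le_prod_smul_pi {ι : Type*} [Fintype ι] {α : ι → Type*}
    [∀ i, MeasurableSpace (α i)] (μ ν : ∀ i, Measure (α i)) [∀ i, SigmaFinite (μ i)]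
    (a : ι → ENNReal) (ha0 : ∀ i, a i ≠ 0) (ha : ∀ i, a i ≠ ⊤)
    (h : ∀ i, μ i ≤ a i • ν i) :
    Measure.pi μ ≤ (∏ i, a i) • Measure.pi ν := by
  have hp0 : ∏ i, a i ≠ 0 := Finset.prod_ne_zero_iff.2 fun i _ => ha0 i
  have hp : ∏ i, a i ≠ ⊤ := ENNReal.prod_ne_top fun i _ => ha i
  have key : (∏ i, a i)⁻¹ • (Measure.pi μ).toOuterMeasure ≤
      OuterMeasure.pi fun i => (ν i).toOuterMeasure := by
    refine OuterMeasure.le_pi.2 fun s _ => ?_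
    change (∏ i, a i)⁻¹ * Measure.pi μ (Set.univ.pi s) ≤ ∏ i, ν i (s i)
    rw [Measure.pi_pi, ENNReal.inv_mul_le_iff hp0 hp, ← Finset.prod_mul_distrib]
    exact Finset.prod_le_prod' fun i _ => h i (s i)
  refine Measure.le_iff.2 fun s hs => ?_
  have hs' : (∏ i, a i)⁻¹ * Measure.pi μ s ≤
      OuterMeasure.pi (fun i => (ν i).toOuterMeasure) s := key s
  rw [ENNReal.inv_mul_le_iff hp0 hp] at hs'
  rwa [Measure.smul_apply, smul_eq_mul, Measure.pi_def ν, toMeasure_apply _ _ hs]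

theorem withDensity_laplace_le {σ : ℝ} (hσ : 0 < σ) (c d : ℝ) :
    (volume.withDensity fun x => ENNReal.ofReal ((1 / (2 * σ)) * Real.exp (-|x - c| / σ))) ≤
      ENNReal.ofReal (Real.exp (|c - d| / σ)) •
        volume.withDensity fun x =>
          ENNReal.ofReal ((1 / (2 * σ)) * Real.exp (-|x - d| / σ)) := by
  rw [← withDensity_smul _ (by fun_prop)]
  refine withDensity_mono (Filter.Eventually.of_forall fun x => ?_)
  simp only [Pi.smul_apply, smul_eq_mul]
  rw [← ENNReal.ofReal_mul (Real.exp_pos _).le, mul_left_comm, ← Real.exp_add, ← add_div]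
  gcongr
  have := abs_sub_le x c d
  linarith

theorem lapPi_le {σ : ℝ} (hσ : 0 < σ) {m : ℕ} (c d : Fin m → ℝ) :
    lapPi σ c ≤ ENNReal.ofReal (Real.exp ((∑ j, |c j - d j|) / σ)) • lapPi σ d := by
  have h := Measure.pi_le_prod_smul_pi _ _
    (fun j => ENNReal.ofReal (Real.exp (|c j - d j| / σ)))
    (fun j => (ENNReal.ofReal_pos.2 (Real.exp_pos _)).ne') (fun j => ENNReal.ofReal_ne_top)
    (fun j => withDensity_laplace_le hσ (c j) (d j))
  rwa [← ENNReal.ofReal_prod_of_nonneg fun j _ => (Real.exp_pos _).le, ← Real.exp_sum,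
    ← Finset.sum_div] at h

/-- Changing one record moves the aggregated coefficients by at most `2 * B` in `ℓ¹` norm. -/
theorem sum_abs_sum_sub_sum_le {T : Type*} {m n : ℕ} (lam : T → Fin m → ℝ) {B : ℝ}
    (hbound : ∀ t, ∑ j, |lam t j| ≤ B) (D D' : Fin n → T) (r : Fin n)
    (hagree : ∀ i, i ≠ r → D i = D' i) :
    ∑ j, |∑ i, lam (D i) j - ∑ i, lam (D' i) j| ≤ 2 * B := by
  have heq : ∀ j, ∑ i, lam (D i) j - ∑ i, lam (D' i) j = lam (D r) j - lam (D' r) j := by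
    intro j
    rw [← Finset.sum_sub_distrib]
    refine Finset.sum_eq_single r (fun i _ hi => ?_) (by simp)
    rw [hagree i hi, sub_self]
  calc ∑ j, |∑ i, lam (D i) j - ∑ i, lam (D' i) j|
      ≤ ∑ j, (|lam (D r) j| + |lam (D' r) j|) :=
        Finset.sum_le_sum fun j _ => by rw [heq]; exact abs_sub _ _
    _ ≤ 2 * B := by
        rw [Finset.sum_add_distrib]
        linarith [hbound (D r), hbound (D' r)]

/-- Theorem 1 of the paper: the functional mechanism, releasing the aggregated
polynomial coefficients `q(D) j = ∑_i λ (D i) j` perturbed by independent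
Laplace noise of scale `σ = Δ/ε` on each coordinate (where `Δ ≥ 2B` bounds the
global sensitivity), satisfies ε-differential privacy with respect to the dataset. -/
theorem functional_mechanism_dp {T : Type*} (m n : ℕ) (lam : T → Fin m → ℝ)
    (B : ℝ) (hB : 0 ≤ B) (hbound : ∀ t, ∑ j, |lam t j| ≤ B)
    (Δ ε : ℝ) (hΔB : 2 * B ≤ Δ) (hΔ : 0 < Δ) (hε : 0 < ε)
    (σ : ℝ) (hσ : σ = Δ / ε)
    (D D' : Fin n → T) (r : Fin n) (hagree : ∀ i, i ≠ r → D i = D' i)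
    (Z : Set (Fin m → ℝ)) (hZ : MeasurableSet Z) :
    lapPi σ (fun j => ∑ i, lam (D i) j) Z ≤
      ENNReal.ofReal (Real.exp ε) * lapPi σ (fun j => ∑ i, lam (D' i) j) Z := by
  have hσpos : 0 < σ := hσ ▸ div_pos hΔ hε
  refine (lapPi_le hσpos _ (fun j => ∑ i, lam (D' i) j) Z).trans ?_
  rw [Measure.smul_apply, smul_eq_mul]
  gcongr
  rw [div_le_iff₀ hσpos, hσ, mul_div_cancel₀ Δ hε.ne']
  exact (sum_abs_sum_sub_sum_le lam hbound D D' r hagree).trans hΔB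
end

section
/- Let σ > 0, m ∈ ℕ, S ⊆ Fin m, and a, b : Fin m → ℝ with a j = b j for every j ∉ S. Let Δ > 0, ε > 0, Δ' ≥ 0, suppose σ = Δ/ε and ∑_{j ∈ S} |a j − b j| ≤ Δ'. Let Lap_σ^m(c) denote the product measure on (Fin m → ℝ) whose j-th factor has density x ↦ (1/(2σ))·exp(−|x − c j|/σ) with respect to Lebesgue measure. Then for every measurable set Z ⊆ (Fin m → ℝ), Lap_σ^m(a)(Z) ≤ exp((Δ'/Δ)·ε) · Lap_σ^m(b)(Z). -/
open MeasureTheory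

/-- Factorwise domination of measures up to constants passes to product measures. -/
theorem pi_apply_le_prod_mul {ι : Type*} [Fintype ι] {α : ι → Type*}
    [∀ i, MeasurableSpace (α i)] (μ ν : ∀ i, Measure (α i)) (k : ι → ENNReal)
    (hk : ∀ i, k i ≠ ⊤) (h : ∀ i, μ i ≤ k i • ν i)
    {Z : Set (∀ i, α i)} (hZ : MeasurableSet Z) :
    Measure.pi μ Z ≤ (∏ i, k i) * Measure.pi ν Z := by
  have htop : ∏ i, k i ≠ ⊤ := ENNReal.prod_ne_top fun i _ => hk i
  have key : OuterMeasure.pi (fun i => (μ i).toOuterMeasure) ≤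
      (∏ i, k i) • OuterMeasure.pi (fun i => (ν i).toOuterMeasure) := by
    unfold OuterMeasure.pi
    rw [OuterMeasure.smul_boundedBy htop, OuterMeasure.le_boundedBy]
    intro s
    refine (OuterMeasure.boundedBy_le s).trans ?_
    simp only [piPremeasure, Pi.smul_apply, smul_eq_mul, ← Finset.prod_mul_distrib]
    exact Finset.prod_le_prod' fun i _ => h i _
  rw [Measure.pi, Measure.pi, toMeasure_apply _ _ hZ, toMeasure_apply _ _ hZ]
  exact key Z

/-- Shifting the centre of a Laplace density by `u - v` changes it by a factor of at most
`exp (|u - v| / σ)`. -/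
theorem laplace_withDensity_le {σ : ℝ} (hσ : 0 < σ) (u v : ℝ) :
    (volume.withDensity fun x : ℝ =>
        ENNReal.ofReal ((1 / (2 * σ)) * Real.exp (-|x - u| / σ))) ≤
      ENNReal.ofReal (Real.exp (|u - v| / σ)) • (volume.withDensity fun x : ℝ =>
        ENNReal.ofReal ((1 / (2 * σ)) * Real.exp (-|x - v| / σ))) := by
  rw [← withDensity_smul _ (by fun_prop)]
  refine withDensity_mono (Filter.Eventually.of_forall fun x => ?_)
  simp only [Pi.smul_apply, smul_eq_mul]
  rw [← ENNReal.ofReal_mul (Real.exp_pos _).le, mul_left_comm, ← Real.exp_add, ← add_div]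
  gcongr
  have := abs_sub_le x u v
  linarith

/-- Theorem 2 of the paper (local differential privacy for parties): if the two
coefficient vectors `a` and `b` agree outside a subset `S` and their ℓ₁ distance on
`S` is at most the local sensitivity `Δ'`, while the noise scale is calibrated to
the global sensitivity `Δ` (i.e. `σ = Δ/ε`), the mechanism satisfies
`(Δ'/Δ)·ε`-differential privacy. -/
theorem local_dp_for_party (σ : ℝ) (hσ : 0 < σ) (m : ℕ) (S : Finset (Fin m))
    (a b : Fin m → ℝ) (hab : ∀ j ∉ S, a j = b j)
    (Δ ε Δ' : ℝ) (hΔ : 0 < Δ) (hε : 0 < ε) (hΔ' : 0 ≤ Δ')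
    (hσeq : σ = Δ / ε) (hsum : ∑ j ∈ S, |a j - b j| ≤ Δ')
    (Z : Set (Fin m → ℝ)) (hZ : MeasurableSet Z) :
    lapPi σ a Z ≤ ENNReal.ofReal (Real.exp ((Δ' / Δ) * ε)) * lapPi σ b Z := by
  refine (pi_apply_le_prod_mul _ _ (fun j => ENNReal.ofReal (Real.exp (|a j - b j| / σ)))
    (fun _ => ENNReal.ofReal_ne_top) (fun j => laplace_withDensity_le hσ (a j) (b j)) hZ).trans ?_
  rw [← ENNReal.ofReal_prod_of_nonneg fun _ _ => (Real.exp_pos _).le, ← Real.exp_sum,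
    ← Finset.sum_div]
  unfold lapPi
  gcongr
  have hS : ∑ j ∈ S, |a j - b j| = ∑ j, |a j - b j| :=
    Finset.sum_subset (Finset.subset_univ S) fun j _ hj => by simp [hab j hj]
  rw [← hS, div_mul_eq_mul_div, ← div_div_eq_mul_div, ← hσeq]
  gcongr
end
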